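/- arXiv:2603.01368 — 2 statements merged into one kernel-verified Lean document; each statement's English description precedes it below -/
import Mathlib

section
/- The inversion walk undergoes total-variation cutoff at time n: for every fixed δ ∈ (0,1), d_n(⌊(1−δ)n⌋) → 1 and d_n(⌈(1+δ)n⌉) → 0 as n → ∞. -/
open scoped BigOperators

/-- Index type for the coordinates of `F_2^{C(n,2)}`: unordered pairs `{i,j} ⊆ [n]`,
represented as ordered pairs `(i,j)` with `i < j`. -/
def PairIdx (n : ℕ) := {p : Fin n × Fin n // p.1 < p.2}

instance (n : ℕ) : Fintype (PairIdx n) := by unfold PairIdx; infer_instance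
instance (n : ℕ) : DecidableEq (PairIdx n) := by unfold PairIdx; infer_instance

/-- The clique vector `v_X ∈ F_2^{C(n,2)}`: coordinate at `{i,j}` is `1` iff `{i,j} ⊆ X`. -/
def cliqueVec (n : ℕ) (X : Finset (Fin n)) : PairIdx n → ZMod 2 :=
  fun p => if p.1.1 ∈ X ∧ p.1.2 ∈ X then 1 else 0

/-- `μ_t(z)`: the distribution at time `t` of the inversion walk started at `0`, i.e. the
probability that `v_{X_1} + ⋯ + v_{X_t} = z` for i.i.d. uniform subsets `X_1,…,X_t ⊆ [n]`.
This equals the `t`-fold convolution power of the step distribution. -/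
noncomputable def invMu (n t : ℕ) (z : PairIdx n → ZMod 2) : ℝ :=
  ((Finset.univ.filter (fun Xs : Fin t → Finset (Fin n) =>
      ∑ i, cliqueVec n (Xs i) = z)).card : ℝ) / 2 ^ (n * t)

/-- `d_n(t)`: total-variation distance of `μ_t` from the uniform distribution on
`F_2^{C(n,2)}`. -/
noncomputable def invDist (n t : ℕ) : ℝ :=
  (1 / 2) * ∑ z : PairIdx n → ZMod 2, |invMu n t z - ((2 : ℝ) ^ n.choose 2)⁻¹|

open Module Submodule

/-- The off-diagonal Gram data of a family of vectors over `F_2`. -/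
def gramVec {n : ℕ} {ι : Type*} [Fintype ι] (r : Fin n → ι → ZMod 2) : PairIdx n → ZMod 2 :=
  fun p => r p.1.1 ⬝ᵥ r p.1.2

lemma gramVec_eq_iff {n : ℕ} {ι κ : Type*} [Fintype ι] [Fintype κ] {r : Fin n → ι → ZMod 2}
    {s : Fin n → κ → ZMod 2} :
    gramVec r = gramVec s ↔ ∀ i j, i < j → r i ⬝ᵥ r j = s i ⬝ᵥ s j :=
  ⟨fun h i j hij => congrFun h ⟨(i, j), hij⟩, fun h => funext fun p => h _ _ p.2⟩

lemma gramVec_eq_zero_iff {n : ℕ} {ι : Type*} [Fintype ι] {r : Fin n → ι → ZMod 2} :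
    gramVec r = 0 ↔ ∀ i j, i < j → r i ⬝ᵥ r j = 0 :=
  ⟨fun h i j hij => congrFun h ⟨(i, j), hij⟩, fun h => funext fun p => h _ _ p.2⟩

lemma gramVec_cons_eq_zero_iff {n : ℕ} {ι : Type*} [Fintype ι] {v : ι → ZMod 2}
    {r : Fin n → ι → ZMod 2} :
    gramVec (Fin.cons v r : Fin (n + 1) → ι → ZMod 2) = 0 ↔
      (∀ i, v ⬝ᵥ r i = 0) ∧ gramVec r = 0 := by
  simp only [gramVec_eq_zero_iff, Fin.forall_fin_succ, Fin.cons_zero, Fin.cons_succ,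
    Fin.succ_lt_succ_iff, Fin.not_lt_zero, Fin.succ_pos]
  simp

/-- Tuples of subsets of `[n]` correspond to the rows of their incidence matrix. -/
def incidenceRows (n : ℕ) (ι : Type*) : (ι → Finset (Fin n)) ≃ (Fin n → ι → ZMod 2) where
  toFun X i a := if i ∈ X a then 1 else 0
  invFun r a := Finset.univ.filter fun i => r i a = 1
  left_inv X := by ext a i; simp
  right_inv r := by
    ext i a
    have : ∀ x : ZMod 2, (if x = 1 then (1 : ZMod 2) else 0) = x := by decide
    simp [this]

lemma sum_cliqueVec {n : ℕ} {ι : Type*} [Fintype ι] (X : ι → Finset (Fin n)) :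
    ∑ a, cliqueVec n (X a) = gramVec (incidenceRows n ι X) := by
  funext p
  simp [gramVec, cliqueVec, incidenceRows, dotProduct, ← ite_and, Finset.sum_apply, and_comm]

lemma invMu_eq (n t : ℕ) (z : PairIdx n → ZMod 2) :
    invMu n t z =
      ((Finset.univ.filter fun r : Fin n → Fin t → ZMod 2 => gramVec r = z).card : ℝ)
        / 2 ^ (n * t) := by
  unfold invMu
  congr 2
  refine Finset.card_equiv (incidenceRows n (Fin t)) fun X => ?_
  simp [sum_cliqueVec]

lemma card_filter_pairIdx_mem (n : ℕ) (T : Finset (Fin n)) :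
    ((Finset.univ : Finset (PairIdx n)).filter fun p => p.1.1 ∈ T ∧ p.1.2 ∈ T).card
      = T.card.choose 2 := by
  rw [← Sym2.card_image_offDiag]
  refine Finset.card_bij (fun p _ => s(p.1.1, p.1.2)) ?_ ?_ ?_
  · intro p hp
    simp only [Finset.mem_filter, Finset.mem_univ, true_and] at hp
    exact Finset.mem_image.2 ⟨p.1, Finset.mem_offDiag.2 ⟨hp.1, hp.2, p.2.ne⟩, rfl⟩
  · rintro ⟨⟨a, b⟩, h⟩ _ ⟨⟨c, d⟩, h'⟩ _ he
    simp only [Sym2.eq_iff] at he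
    rcases he with ⟨rfl, rfl⟩ | ⟨rfl, rfl⟩
    · rfl
    · exact absurd h (lt_asymm h')
  · intro s hs
    obtain ⟨⟨a, b⟩, hab, rfl⟩ := Finset.mem_image.1 hs
    obtain ⟨ha, hb, hne⟩ := Finset.mem_offDiag.1 hab
    rcases lt_or_gt_of_ne hne with h | h
    · exact ⟨⟨(a, b), h⟩, Finset.mem_filter.2 ⟨Finset.mem_univ _, ha, hb⟩, rfl⟩
    · exact ⟨⟨(b, a), h⟩, Finset.mem_filter.2 ⟨Finset.mem_univ _, hb, ha⟩, Sym2.eq_swap⟩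

lemma card_pairIdx (n : ℕ) : Fintype.card (PairIdx n) = n.choose 2 := by
  simpa using card_filter_pairIdx_mem n Finset.univ

lemma card_pairIdx_fun (n : ℕ) : Fintype.card (PairIdx n → ZMod 2) = 2 ^ n.choose 2 := by
  simp [card_pairIdx]

lemma card_forall_dotProduct_eq_zero {ι κ : Type*} [Fintype ι] (r : κ → ι → ZMod 2) :
    2 ^ finrank (ZMod 2) (span (ZMod 2) (Set.range r)) *
      Nat.card {v : ι → ZMod 2 // ∀ i, v ⬝ᵥ r i = 0} = 2 ^ Fintype.card ι := by
  classical
  let B : LinearMap.BilinForm (ZMod 2) (ι → ZMod 2) := dotProductBilin (ZMod 2) (ZMod 2)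
  have hker : B.ker = ⊥ := by
    rw [LinearMap.ker_eq_bot']
    intro v hv
    exact dotProduct_eq_zero v fun w => LinearMap.congr_fun hv w
  have h := LinearMap.BilinForm.finrank_add_finrank_orthogonal' (B := B)
    (span (ZMod 2) (Set.range r))
  rw [hker, inf_bot_eq, finrank_bot, add_zero, finrank_fintype_fun_eq_card] at h
  have hcard : Nat.card {v : ι → ZMod 2 // ∀ i, v ⬝ᵥ r i = 0} =
      Nat.card (B.orthogonal (span (ZMod 2) (Set.range r))) := by
    refine Nat.card_congr (Equiv.subtypeEquivRight fun v => ?_)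
    rw [LinearMap.BilinForm.mem_orthogonal_iff]
    constructor
    · intro hv w hw
      change w ⬝ᵥ v = 0
      induction hw using Submodule.span_induction with
      | mem x hx =>
        obtain ⟨i, rfl⟩ := hx
        rw [dotProduct_comm, hv]
      | zero => simp
      | add x y _ _ hx hy => rw [add_dotProduct, hx, hy, add_zero]
      | smul c x _ hx => rw [smul_dotProduct, hx, smul_zero]
    · intro hv i
      rw [dotProduct_comm]
      exact hv _ (subset_span ⟨i, rfl⟩)
  rw [hcard, Module.natCard_eq_pow_finrank (K := ZMod 2), Nat.card_zmod, ← pow_add, h]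

/-- The difference between the length of a family of vectors and the dimension of its span. -/
noncomputable def rankDeficit {k : ℕ} {ι : Type*} (r : Fin k → ι → ZMod 2) : ℕ :=
  k - finrank (ZMod 2) (span (ZMod 2) (Set.range r))

lemma finrank_add_rankDeficit {k : ℕ} {ι : Type*} (r : Fin k → ι → ZMod 2) :
    finrank (ZMod 2) (span (ZMod 2) (Set.range r)) + rankDeficit r = k := by
  have h : (Set.range r).finrank (ZMod 2) ≤ Fintype.card (Fin k) := finrank_range_le_card r
  rw [Fintype.card_fin] at h
  exact Nat.add_sub_cancel' h

lemma rankDeficit_cons_le {k : ℕ} {ι : Type*} [Fintype ι] (v : ι → ZMod 2)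
    (r : Fin k → ι → ZMod 2) :
    rankDeficit (Fin.cons v r : Fin (k + 1) → ι → ZMod 2) ≤ rankDeficit r + 1 := by
  have h1 := finrank_add_rankDeficit r
  have h2 := finrank_add_rankDeficit (Fin.cons v r : Fin (k + 1) → ι → ZMod 2)
  have h3 : finrank (ZMod 2) (span (ZMod 2) (Set.range r)) ≤
      finrank (ZMod 2) (span (ZMod 2)
        (Set.range (Fin.cons v r : Fin (k + 1) → ι → ZMod 2))) := by
    refine finrank_mono (span_mono ?_)
    rw [Fin.range_cons]
    exact Set.subset_insert _ _
  lia

lemma rankDeficit_cons_of_notMem {k : ℕ} {ι : Type*} [Fintype ι] {v : ι → ZMod 2}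
    {r : Fin k → ι → ZMod 2} (hv : v ∉ span (ZMod 2) (Set.range r)) :
    rankDeficit (Fin.cons v r : Fin (k + 1) → ι → ZMod 2) ≤ rankDeficit r := by
  have h1 := finrank_add_rankDeficit r
  have h2 := finrank_add_rankDeficit (Fin.cons v r : Fin (k + 1) → ι → ZMod 2)
  have h3 : finrank (ZMod 2) (span (ZMod 2) (Set.range r)) <
      finrank (ZMod 2) (span (ZMod 2)
        (Set.range (Fin.cons v r : Fin (k + 1) → ι → ZMod 2))) := by
    refine finrank_lt_finrank_of_lt (lt_of_le_of_ne (span_mono ?_) fun h => hv ?_)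
    · rw [Fin.range_cons]
      exact Set.subset_insert _ _
    · rw [h, Fin.range_cons]
      exact subset_span (Set.mem_insert _ _)
  lia

/-- Exponential moment of the rank deficit over all pairwise orthogonal families. -/
noncomputable def orthMoment (ι : Type*) [Fintype ι] [DecidableEq ι] (k j : ℕ) : ℝ :=
  ∑ r : Fin k → ι → ZMod 2, if gramVec r = 0 then 2 ^ (j * rankDeficit r) else 0

lemma sum_pow_rankDeficit_cons_le {ι : Type*} [Fintype ι] [DecidableEq ι] {k j : ℕ} {ε : ℝ}
    (h : 2 ^ j * 4 ^ k ≤ ε * 2 ^ Fintype.card ι) (r : Fin k → ι → ZMod 2) :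
    ∑ v : ι → ZMod 2, (if ∀ i, v ⬝ᵥ r i = 0 then
        (2 : ℝ) ^ (j * rankDeficit (Fin.cons v r : Fin (k + 1) → ι → ZMod 2)) else 0) ≤
      (1 + ε) * 2 ^ Fintype.card ι / 2 ^ k * 2 ^ ((j + 1) * rankDeficit r) := by
  classical
  set W := span (ZMod 2) (Set.range r) with hW
  set d := finrank (ZMod 2) W with hd
  have hdk : d + rankDeficit r = k := finrank_add_rankDeficit r
  have hperp := card_forall_dotProduct_eq_zero r
  rw [← hW, ← hd, Nat.card_eq_fintype_card, Fintype.card_subtype] at hperp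
  have hspan : (Finset.univ.filter fun v => v ∈ W).card = 2 ^ d := by
    rw [← Fintype.card_subtype, ← Nat.card_eq_fintype_card]
    exact (Module.natCard_eq_pow_finrank (K := ZMod 2)).trans (by rw [Nat.card_zmod])
  set P := (Finset.univ.filter fun v : ι → ZMod 2 => ∀ i, v ⬝ᵥ r i = 0).card with hP
  have hpow : (2 : ℝ) ^ k = 2 ^ d * 2 ^ rankDeficit r := by rw [← pow_add, hdk]
  have hperp' : (2 : ℝ) ^ d * P = 2 ^ Fintype.card ι := by exact_mod_cast hperp
  have hle : ∀ v : ι → ZMod 2, (if ∀ i, v ⬝ᵥ r i = 0 then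
        (2 : ℝ) ^ (j * rankDeficit (Fin.cons v r : Fin (k + 1) → ι → ZMod 2)) else 0) ≤
      (if ∀ i, v ⬝ᵥ r i = 0 then 2 ^ (j * rankDeficit r) else 0) +
        (if v ∈ W then 2 ^ (j * (rankDeficit r + 1)) else 0) := by
    intro v
    by_cases hv : v ∈ W
    · have : (2 : ℝ) ^ (j * rankDeficit (Fin.cons v r : Fin (k + 1) → ι → ZMod 2)) ≤
          2 ^ (j * (rankDeficit r + 1)) :=
        pow_le_pow_right₀ one_le_two (Nat.mul_le_mul_left _ (rankDeficit_cons_le v r))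
      rw [if_pos hv]
      split_ifs
      · exact this.trans (le_add_of_nonneg_left (by positivity))
      · positivity
    · have : (2 : ℝ) ^ (j * rankDeficit (Fin.cons v r : Fin (k + 1) → ι → ZMod 2)) ≤
          2 ^ (j * rankDeficit r) :=
        pow_le_pow_right₀ one_le_two (Nat.mul_le_mul_left _ (rankDeficit_cons_of_notMem hv))
      rw [if_neg hv, add_zero]
      split_ifs
      · exact this
      · exact le_rfl
  refine (Finset.sum_le_sum fun v _ => hle v).trans ?_
  rw [Finset.sum_add_distrib, ← Finset.sum_filter, ← Finset.sum_filter, Finset.sum_const,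
    Finset.sum_const, hspan, ← hP, nsmul_eq_mul, nsmul_eq_mul, hpow, ← hperp']
  have hj : (2 : ℝ) ^ j * 2 ^ d ≤ ε * P := by
    have h4 : (4 : ℝ) ^ d ≤ 4 ^ k := pow_le_pow_right₀ (by norm_num) (by lia)
    have : (2 : ℝ) ^ d * (2 ^ j * 2 ^ d) ≤ 2 ^ d * (ε * P) := by
      calc (2 : ℝ) ^ d * (2 ^ j * 2 ^ d) = 2 ^ j * 4 ^ d := by
            rw [show (4 : ℝ) = 2 * 2 by norm_num, mul_pow]; ring
        _ ≤ 2 ^ j * 4 ^ k := by gcongr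
        _ ≤ ε * 2 ^ Fintype.card ι := h
        _ = 2 ^ d * (ε * P) := by rw [← hperp']; ring
    exact le_of_mul_le_mul_left this (by positivity)
  have hD : (2 : ℝ) ^ ((j + 1) * rankDeficit r) = 2 ^ (j * rankDeficit r) * 2 ^ rankDeficit r := by
    rw [← pow_add]; ring_nf
  have hD' : (2 : ℝ) ^ (j * (rankDeficit r + 1)) = 2 ^ (j * rankDeficit r) * 2 ^ j := by
    rw [← pow_add]; ring_nf
  rw [hD, hD']
  push_cast
  have : (1 + ε) * (2 ^ d * P) / (2 ^ d * 2 ^ rankDeficit r) *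
      (2 ^ (j * rankDeficit r) * 2 ^ rankDeficit r) =
        2 ^ (j * rankDeficit r) * (P + ε * P) := by
    field_simp
  rw [this]
  nlinarith [mul_le_mul_of_nonneg_left hj
    (by positivity : (0 : ℝ) ≤ 2 ^ (j * rankDeficit r))]

lemma orthMoment_succ_le {ι : Type*} [Fintype ι] [DecidableEq ι] {k j : ℕ} {ε : ℝ}
    (h : 2 ^ j * 4 ^ k ≤ ε * 2 ^ Fintype.card ι) :
    orthMoment ι (k + 1) j ≤ (1 + ε) * 2 ^ Fintype.card ι / 2 ^ k * orthMoment ι k (j + 1) := by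
  unfold orthMoment
  rw [← (Fin.consEquiv fun _ => ι → ZMod 2).sum_comp, Fintype.sum_prod_type_right,
    Finset.mul_sum]
  refine Finset.sum_le_sum fun r _ => ?_
  simp only [Fin.consEquiv, Equiv.coe_fn_mk, gramVec_cons_eq_zero_iff]
  by_cases hr : gramVec r = 0
  · simpa only [hr, and_true, if_true] using sum_pow_rankDeficit_cons_le h r
  · simp [hr]

lemma orthMoment_le {ι : Type*} [Fintype ι] [DecidableEq ι] {ε : ℝ} (hε : 0 ≤ ε) {k j : ℕ}
    (h : 2 ^ j * 4 ^ k ≤ ε * 2 ^ Fintype.card ι) :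
    orthMoment ι k j ≤ (1 + ε) ^ k * 2 ^ (Fintype.card ι * k) / 2 ^ k.choose 2 := by
  induction k generalizing j with
  | zero =>
    have : ∀ r : Fin 0 → ι → ZMod 2, gramVec r = 0 ∧ rankDeficit r = 0 := fun r =>
      ⟨gramVec_eq_zero_iff.2 fun i => i.elim0, Nat.zero_sub _⟩
    simp [orthMoment, this]
  | succ k ih =>
    have h1 : (2 : ℝ) ^ (j + 1) * 4 ^ k ≤ ε * 2 ^ Fintype.card ι := by
      refine le_trans ?_ h
      rw [pow_succ, pow_succ]
      nlinarith [show (0 : ℝ) ≤ 2 ^ j * 4 ^ k by positivity]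
    have h2 : (2 : ℝ) ^ j * 4 ^ k ≤ ε * 2 ^ Fintype.card ι :=
      le_trans (by gcongr <;> norm_num) h
    refine (orthMoment_succ_le h2).trans
      ((mul_le_mul_of_nonneg_left (ih h1) (by positivity)).trans_eq ?_)
    rw [Nat.choose_succ_succ' k 1, Nat.choose_one_right, mul_add, mul_one, pow_add, pow_add,
      pow_succ]
    field_simp
    rw [pow_add]

lemma sum_invMu (n t : ℕ) : ∑ z, invMu n t z = 1 := by
  simp_rw [invMu_eq]
  rw [← Finset.sum_div, ← Nat.cast_sum,
    ← Finset.card_eq_sum_card_fiberwise (fun r _ => Finset.mem_univ (gramVec r))]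
  simp [← pow_mul, mul_comm]

lemma invMu_nonneg (n t : ℕ) (z : PairIdx n → ZMod 2) : 0 ≤ invMu n t z := by
  unfold invMu; positivity

lemma sum_invMu_sq (n t : ℕ) :
    ∑ z, invMu n t z ^ 2 = orthMoment (Fin t ⊕ Fin t) n 0 / 2 ^ (2 * n * t) := by
  have key : ∑ z : PairIdx n → ZMod 2,
      (Finset.univ.filter fun r : Fin n → Fin t → ZMod 2 => gramVec r = z).card ^ 2 =
      (Finset.univ.filter fun r : Fin n → Fin t ⊕ Fin t → ZMod 2 => gramVec r = 0).card := by
    have h1 : ∀ z : PairIdx n → ZMod 2,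
        (Finset.univ.filter fun r : Fin n → Fin t → ZMod 2 => gramVec r = z).card ^ 2 =
        ((Finset.univ.filter fun q : (Fin n → Fin t → ZMod 2) × (Fin n → Fin t → ZMod 2) =>
          gramVec q.1 = gramVec q.2).filter fun q => gramVec q.1 = z).card := by
      intro z
      rw [sq, ← Finset.card_product]
      congr 1
      ext q
      simp only [Finset.mem_product, Finset.mem_filter, Finset.mem_univ, true_and]
      grind
    simp_rw [h1]
    rw [← Finset.card_eq_sum_card_fiberwise (fun q _ => Finset.mem_univ (gramVec q.1))]
    refine Finset.card_bij' (fun q _ i => Sum.elim (q.1 i) (q.2 i))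
      (fun r _ => (fun i a => r i (Sum.inl a), fun i a => r i (Sum.inr a))) ?_ ?_ ?_ ?_
    · intro q hq
      simp only [Finset.mem_filter, Finset.mem_univ, true_and] at hq ⊢
      rw [gramVec_eq_iff] at hq
      rw [gramVec_eq_zero_iff]
      intro i j hij
      rw [sumElim_dotProduct_sumElim, hq i j hij, CharTwo.add_self_eq_zero]
    · intro r hr
      simp only [Finset.mem_filter, Finset.mem_univ, true_and] at hr ⊢
      rw [gramVec_eq_zero_iff] at hr
      rw [gramVec_eq_iff]
      intro i j hij
      have := hr i j hij
      rw [dotProduct, Fintype.sum_sum_type] at this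
      exact CharTwo.add_eq_zero.1 this
    · intro q _; rfl
    · intro r _
      ext i (a | a) <;> rfl
  have hcast := congrArg (Nat.cast : ℕ → ℝ) key
  push_cast at hcast
  simp_rw [invMu_eq, div_pow]
  rw [← Finset.sum_div, hcast]
  congr 1
  · simp [orthMoment]
  · rw [← pow_mul]; ring_nf

lemma sum_uniform (n : ℕ) : ∑ _z : PairIdx n → ZMod 2, ((2 : ℝ) ^ n.choose 2)⁻¹ = 1 := by
  rw [Finset.sum_const, Finset.card_univ, card_pairIdx_fun, nsmul_eq_mul]
  push_cast
  exact mul_inv_cancel₀ (by positivity)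

lemma invDist_nonneg (n t : ℕ) : 0 ≤ invDist n t := by
  unfold invDist; positivity

lemma invDist_le_one (n t : ℕ) : invDist n t ≤ 1 := by
  have : ∑ z : PairIdx n → ZMod 2, |invMu n t z - ((2 : ℝ) ^ n.choose 2)⁻¹| ≤ 1 + 1 := by
    refine le_of_le_of_eq ?_ (congrArg₂ (· + ·) (sum_invMu n t) (sum_uniform n))
    rw [← Finset.sum_add_distrib]
    refine Finset.sum_le_sum fun z _ => (abs_sub _ _).trans_eq ?_
    rw [abs_of_nonneg (invMu_nonneg n t z), abs_of_nonneg (by positivity)]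
  unfold invDist
  linarith

lemma invDist_sq_le {n t : ℕ} {ε : ℝ} (hε : 0 ≤ ε) (h : 4 ^ n ≤ ε * 4 ^ t) :
    4 * invDist n t ^ 2 ≤ (1 + ε) ^ n - 1 := by
  have hcs := sq_sum_le_card_mul_sum_sq (s := (Finset.univ : Finset (PairIdx n → ZMod 2)))
    (f := fun z => |invMu n t z - ((2 : ℝ) ^ n.choose 2)⁻¹|)
  rw [Finset.card_univ, card_pairIdx_fun] at hcs
  have hmom := orthMoment_le (ι := Fin t ⊕ Fin t) (k := n) (j := 0) hε (by
    simp only [Fintype.card_sum, Fintype.card_fin, ← two_mul, pow_mul]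
    norm_num
    exact h)
  have hexp : ∑ z, (invMu n t z - ((2 : ℝ) ^ n.choose 2)⁻¹) ^ 2 =
      ∑ z, invMu n t z ^ 2 - ((2 : ℝ) ^ n.choose 2)⁻¹ := by
    have : ∀ z, (invMu n t z - ((2 : ℝ) ^ n.choose 2)⁻¹) ^ 2 =
        invMu n t z ^ 2 - 2 * ((2 : ℝ) ^ n.choose 2)⁻¹ * invMu n t z +
          ((2 : ℝ) ^ n.choose 2)⁻¹ * ((2 : ℝ) ^ n.choose 2)⁻¹ := fun z => by ring
    simp_rw [this]
    rw [Finset.sum_add_distrib, Finset.sum_sub_distrib, ← Finset.mul_sum, ← Finset.mul_sum,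
      sum_invMu, sum_uniform]
    ring
  simp_rw [sq_abs] at hcs
  rw [hexp, sum_invMu_sq] at hcs
  have hcard : Fintype.card (Fin t ⊕ Fin t) * n = 2 * n * t := by
    simp; ring
  rw [hcard] at hmom
  calc 4 * invDist n t ^ 2
      = (∑ z : PairIdx n → ZMod 2, |invMu n t z - ((2 : ℝ) ^ n.choose 2)⁻¹|) ^ 2 := by
        unfold invDist; ring
    _ ≤ _ := hcs
    _ ≤ 2 ^ n.choose 2 * ((1 + ε) ^ n * 2 ^ (2 * n * t) / 2 ^ n.choose 2 / 2 ^ (2 * n * t)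
          - ((2 : ℝ) ^ n.choose 2)⁻¹) := by
        push_cast
        gcongr
    _ = (1 + ε) ^ n - 1 := by field_simp

lemma one_sub_card_support_le_invDist (n t : ℕ) :
    1 - ((Finset.univ.image (gramVec : (Fin n → Fin t → ZMod 2) → _)).card : ℝ) / 2 ^ n.choose 2
      ≤ invDist n t := by
  set s := Finset.univ.image (gramVec : (Fin n → Fin t → ZMod 2) → PairIdx n → ZMod 2) with hs
  set u : ℝ := ((2 : ℝ) ^ n.choose 2)⁻¹ with hu
  have hle : ∀ z, invMu n t z - u + 2 * (u - if z ∈ s then u else 0) ≤ |invMu n t z - u| := by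
    intro z
    by_cases hz : z ∈ s
    · rw [if_pos hz]
      linarith [le_abs_self (invMu n t z - u)]
    · have h0 : invMu n t z = 0 := by
        rw [invMu_eq, Finset.filter_eq_empty_iff.2, Finset.card_empty, Nat.cast_zero, zero_div]
        intro r _ hr
        exact hz (Finset.mem_image.2 ⟨r, Finset.mem_univ _, hr⟩)
      rw [if_neg hz, h0]
      linarith [neg_le_abs (0 - u)]
  have hsum := Finset.sum_le_sum fun z (_ : z ∈ Finset.univ) => hle z
  rw [Finset.sum_add_distrib, Finset.sum_sub_distrib, ← Finset.mul_sum, Finset.sum_sub_distrib,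
    sum_invMu, sum_uniform, ← Finset.sum_filter, Finset.filter_univ_mem, Finset.sum_const,
    nsmul_eq_mul] at hsum
  rw [div_eq_mul_inv, ← hu]
  unfold invDist
  linarith

lemma dotProduct_eq_of_mem_span {α ι κ : Type*} [Fintype ι] [Fintype κ] {S : Finset α}
    {r : α → ι → ZMod 2} {r' : α → κ → ZMod 2}
    (hr : ∀ i, r i ∈ span (ZMod 2) (r '' S)) (hr' : ∀ i, r' i ∈ span (ZMod 2) (r' '' S))
    (h : ∀ i, ∀ s ∈ S, r i ⬝ᵥ r s = r' i ⬝ᵥ r' s) (i j : α) :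
    r i ⬝ᵥ r j = r' i ⬝ᵥ r' j := by
  obtain ⟨c, hc⟩ := (mem_span_image_finset_iff_exists_fun _).1 (hr j)
  have key : ∀ k, r' k ⬝ᵥ (∑ s : S, c s • r' s) = r k ⬝ᵥ r j := by
    intro k
    rw [← hc, dotProduct_sum, dotProduct_sum]
    refine Finset.sum_congr rfl fun s _ => ?_
    rw [dotProduct_smul, dotProduct_smul, h k s s.2]
  rw [← key i]
  have hi := hr' i
  generalize r' i = w at hi
  induction hi using span_induction with
  | mem x hx =>
    obtain ⟨s, hs, rfl⟩ := hx
    rw [key, dotProduct_comm, h j s hs, dotProduct_comm]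
  | zero => simp
  | add x y _ _ hx hy => rw [add_dotProduct, hx, hy, add_dotProduct]
  | smul c x _ hx => rw [smul_dotProduct, hx, smul_dotProduct]

lemma exists_finset_span_image_eq {α ι : Type*} [Finite α] [Fintype ι] (r : α → ι → ZMod 2) :
    ∃ S : Finset α, S.card ≤ Fintype.card ι ∧ ∀ i, r i ∈ span (ZMod 2) (r '' S) := by
  classical
  obtain ⟨κ, a, ha, hspan, hli⟩ := exists_linearIndependent' (ZMod 2) r
  have := Finite.of_injective a ha
  have := Fintype.ofFinite κ
  refine ⟨Finset.univ.image a, ?_, fun i => ?_⟩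
  · rw [Finset.card_image_of_injective _ ha, Finset.card_univ]
    simpa using hli.fintype_card_le_finrank
  · rw [Finset.coe_image, Finset.coe_univ, Set.image_univ, ← Set.range_comp, hspan]
    exact subset_span ⟨i, rfl⟩

lemma card_image_gramVec_le {n : ℕ} {ι : Type*} [Fintype ι] (S : Finset (Fin n))
    (Q : Finset (Fin n → ι → ZMod 2)) (hQ : ∀ r ∈ Q, ∀ i, r i ∈ span (ZMod 2) (r '' S)) :
    (Q.image gramVec).card * 2 ^ (n - S.card).choose 2 ≤ 2 ^ n * 2 ^ n.choose 2 := by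
  have hchoose := fun z : Q.image gramVec => Finset.mem_image.1 z.2
  choose r hrQ hr using hchoose
  let T := {p : PairIdx n // ¬ (p.1.1 ∈ Sᶜ ∧ p.1.2 ∈ Sᶜ)}
  let f : Q.image gramVec → (Fin n → ZMod 2) × (T → ZMod 2) :=
    fun z => (fun i => r z i ⬝ᵥ r z i, fun p => gramVec (r z) p.1)
  have hf : Function.Injective f := by
    intro z w hzw
    obtain ⟨hdiag, hoff⟩ := Prod.ext_iff.1 hzw
    have hlt : ∀ i j, i < j → ¬ (i ∈ Sᶜ ∧ j ∈ Sᶜ) → r z i ⬝ᵥ r z j = r w i ⬝ᵥ r w j :=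
      fun i j hij hS => congrFun hoff ⟨⟨(i, j), hij⟩, hS⟩
    have hS : ∀ i, ∀ s ∈ S, r z i ⬝ᵥ r z s = r w i ⬝ᵥ r w s := by
      intro i s hs
      rcases lt_trichotomy i s with h | rfl | h
      · exact hlt i s h (by simp [hs])
      · exact congrFun hdiag i
      · rw [dotProduct_comm, dotProduct_comm (r w i)]
        exact hlt s i h (by simp [hs])
    refine Subtype.ext ?_
    rw [← hr z, ← hr w, gramVec_eq_iff]
    exact fun i j _ => dotProduct_eq_of_mem_span (hQ _ (hrQ z)) (hQ _ (hrQ w)) hS i j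
  have hcard := Fintype.card_le_of_injective f hf
  have hT : Fintype.card T + (n - S.card).choose 2 = n.choose 2 := by
    have h1 := card_filter_pairIdx_mem n Sᶜ
    rw [Finset.card_compl, Fintype.card_fin] at h1
    rw [← h1, ← card_pairIdx n, ← Finset.card_univ (α := PairIdx n), Fintype.card_subtype,
      add_comm]
    exact Finset.card_filter_add_card_filter_not _
  rw [Fintype.card_coe, Fintype.card_prod, Fintype.card_fun, Fintype.card_fun, ZMod.card,
    Fintype.card_fin] at hcard
  calc _ ≤ 2 ^ n * 2 ^ Fintype.card T * 2 ^ (n - S.card).choose 2 := by gcongr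
    _ = 2 ^ n * 2 ^ n.choose 2 := by rw [mul_assoc, ← pow_add, hT]

lemma card_support_le (n t : ℕ) :
    (Finset.univ.image (gramVec : (Fin n → Fin t → ZMod 2) → _)).card * 2 ^ (n - t).choose 2
      ≤ 2 ^ (2 * n) * 2 ^ n.choose 2 := by
  classical
  let Q : Finset (Fin n) → Finset (Fin n → Fin t → ZMod 2) := fun S =>
    Finset.univ.filter fun r => S.card ≤ t ∧ ∀ i, r i ∈ span (ZMod 2) (r '' S)
  have hsub : Finset.univ.image (gramVec : (Fin n → Fin t → ZMod 2) → PairIdx n → ZMod 2) ⊆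
      Finset.univ.biUnion fun S => (Q S).image gramVec := by
    intro z hz
    obtain ⟨r, -, rfl⟩ := Finset.mem_image.1 hz
    obtain ⟨S, hS, hr⟩ := exists_finset_span_image_eq r
    rw [Fintype.card_fin] at hS
    exact Finset.mem_biUnion.2 ⟨S, Finset.mem_univ _, Finset.mem_image.2
      ⟨r, Finset.mem_filter.2 ⟨Finset.mem_univ _, hS, hr⟩, rfl⟩⟩
  have hQ : ∀ S, ((Q S).image gramVec).card * 2 ^ (n - t).choose 2 ≤ 2 ^ n * 2 ^ n.choose 2 := by
    intro S
    by_cases hS : S.card ≤ t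
    · refine le_trans ?_ (card_image_gramVec_le S (Q S) fun r hr => (Finset.mem_filter.1 hr).2.2)
      gcongr
      norm_num
    · simp [Q, hS]
  calc _ ≤ (∑ S, ((Q S).image gramVec).card) * 2 ^ (n - t).choose 2 := by
        gcongr
        exact (Finset.card_le_card hsub).trans Finset.card_biUnion_le
    _ ≤ ∑ _S : Finset (Fin n), 2 ^ n * 2 ^ n.choose 2 := by
        rw [Finset.sum_mul]
        exact Finset.sum_le_sum fun S _ => hQ S
    _ = 2 ^ (2 * n) * 2 ^ n.choose 2 := by
        simp [two_mul, pow_add, mul_assoc]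

lemma one_sub_half_pow_le_invDist {n t : ℕ} (h : 3 * n ≤ (n - t).choose 2) :
    1 - (1 / 2 : ℝ) ^ n ≤ invDist n t := by
  refine le_trans (sub_le_sub_left ?_ 1) (one_sub_card_support_le_invDist n t)
  have hcard := (Nat.mul_le_mul_left _ (Nat.pow_le_pow_right two_pos h)).trans (card_support_le n t)
  have hcast : ((Finset.univ.image (gramVec : (Fin n → Fin t → ZMod 2) → _)).card : ℝ)
      * 2 ^ (3 * n) ≤ 2 ^ (2 * n) * 2 ^ n.choose 2 := by exact_mod_cast hcard
  rw [div_le_iff₀ (by positivity)]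
  have h3 : (2 : ℝ) ^ (3 * n) = 2 ^ (2 * n) * 2 ^ n := by rw [← pow_add]; ring_nf
  have h2 : (0 : ℝ) < 2 ^ (2 * n) := by positivity
  rw [h3] at hcast
  have : (1 / 2 : ℝ) ^ n * 2 ^ n = 1 := by rw [← mul_pow]; norm_num
  have hn : (0 : ℝ) < 2 ^ n := by positivity
  refine le_of_mul_le_mul_right (hcast.trans_eq ?_) (mul_pos h2 hn)
  linear_combination (-(2 : ℝ) ^ (2 * n) * 2 ^ n.choose 2) * this

lemma three_mul_le_choose_two {δ : ℝ} (hδ : 0 < δ) {n k : ℕ} (hk : δ * n ≤ k)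
    (hn : (6 / δ + 1) / δ ≤ n) : 3 * n ≤ k.choose 2 := by
  have h1 : 6 / δ + 1 ≤ δ * n := by rwa [div_le_iff₀' hδ] at hn
  have h2 : 6 ≤ δ * (δ * n - 1) := by
    rw [← div_le_iff₀' hδ]
    linarith
  have h3 : (3 * n : ℝ) ≤ k.choose 2 := by
    rw [Nat.cast_choose_two]
    have h6 : 0 < 6 / δ := by positivity
    have h4 : δ * n * (δ * n - 1) ≤ k * (k - 1) :=
      mul_le_mul hk (by linarith) (by linarith) (by positivity)
    nlinarith [mul_le_mul_of_nonneg_left h2 (Nat.cast_nonneg (α := ℝ) n)]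
  exact_mod_cast h3

lemma four_mul_invDist_sq_le_exp {δ : ℝ} {n t : ℕ} (ht : (1 + δ) * n ≤ t) :
    4 * invDist n t ^ 2 ≤ Real.exp (n * ((4 : ℝ) ^ (-δ)) ^ n) - 1 := by
  have hq : 0 ≤ ((4 : ℝ) ^ (-δ)) ^ n := by positivity
  have h4 : (4 : ℝ) ^ n ≤ ((4 : ℝ) ^ (-δ)) ^ n * 4 ^ t := by
    rw [← Real.rpow_natCast 4 n, ← Real.rpow_natCast 4 t, ← Real.rpow_natCast (_ ^ (-δ)),
      ← Real.rpow_mul (by norm_num), ← Real.rpow_add (by norm_num)]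
    exact Real.rpow_le_rpow_of_exponent_le (by norm_num) (by linarith)
  refine (invDist_sq_le hq h4).trans (sub_le_sub_right ?_ 1)
  rw [Real.exp_nat_mul]
  gcongr
  linarith [Real.add_one_le_exp (((4 : ℝ) ^ (-δ)) ^ n)]

/-- The inversion walk undergoes total-variation cutoff at time `n`: for every fixed
`δ ∈ (0,1)`, `d_n(⌊(1-δ)n⌋) → 1` and `d_n(⌈(1+δ)n⌉) → 0` as `n → ∞`. -/
theorem inversion_walk_cutoff (δ : ℝ) (hδ0 : 0 < δ) (hδ1 : δ < 1) :
    Filter.Tendsto (fun n : ℕ => invDist n ⌊(1 - δ) * n⌋₊) Filter.atTop (nhds 1) ∧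
    Filter.Tendsto (fun n : ℕ => invDist n ⌈(1 + δ) * n⌉₊) Filter.atTop (nhds 0) := by
  constructor
  · have hlow : Filter.Tendsto (fun n : ℕ => 1 - (1 / 2 : ℝ) ^ n) Filter.atTop (nhds 1) := by
      simpa using (tendsto_pow_atTop_nhds_zero_of_lt_one (r := (1 / 2 : ℝ)) (by norm_num)
        (by norm_num)).const_sub 1
    refine tendsto_of_tendsto_of_tendsto_of_le_of_le' hlow tendsto_const_nhds ?_
      (Filter.Eventually.of_forall fun n => invDist_le_one n _)
    filter_upwards [Filter.eventually_ge_atTop ⌈(6 / δ + 1) / δ⌉₊] with n hn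
    refine one_sub_half_pow_le_invDist (three_mul_le_choose_two hδ0 ?_ (Nat.ceil_le.1 hn))
    have hfloor : (⌊(1 - δ) * n⌋₊ : ℝ) ≤ (1 - δ) * n :=
      Nat.floor_le (mul_nonneg (by linarith) (Nat.cast_nonneg n))
    have hle : ⌊(1 - δ) * n⌋₊ ≤ n := by
      have : (⌊(1 - δ) * n⌋₊ : ℝ) ≤ n := by nlinarith [Nat.cast_nonneg (α := ℝ) n]
      exact_mod_cast this
    rw [Nat.cast_sub hle]
    linarith
  · have hq : Filter.Tendsto (fun n : ℕ => (n : ℝ) * ((4 : ℝ) ^ (-δ)) ^ n) Filter.atTop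
        (nhds 0) :=
      tendsto_self_mul_const_pow_of_lt_one (by positivity)
        (Real.rpow_lt_one_of_one_lt_of_neg (by norm_num) (by linarith))
    have hup : Filter.Tendsto
        (fun n : ℕ => √((Real.exp (n * ((4 : ℝ) ^ (-δ)) ^ n) - 1) / 4)) Filter.atTop (nhds 0) := by
      have := (((Real.continuous_exp.tendsto 0).comp hq).sub_const 1).div_const 4
      simpa [Function.comp_def] using (Real.continuous_sqrt.tendsto _).comp this
    refine squeeze_zero (fun n => invDist_nonneg n _) (fun n => ?_) hup
    refine Real.le_sqrt_of_sq_le ?_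
    linarith [four_mul_invDist_sq_le_exp (Nat.le_ceil ((1 + δ) * (n : ℝ)))]
end

section
/- Let n ≥ 4 and 2 ≤ k ≤ n − 2 with k ≡ 3 (mod 4). Then H_k, the F_2-span of the clique vectors {v_X : X ⊆ [n], |X| = k}, equals ker(∂), the subspace of F_2^{C(n,2)} consisting of edge-sets in which every vertex has even degree. -/
open scoped BigOperators

/-- `H_k`: the `F_2`-linear span of the clique vectors `{v_X : X ⊆ [n], |X| = k}`. -/
def Hk (n k : ℕ) : Submodule (ZMod 2) (PairIdx n → ZMod 2) :=
  Submodule.span (ZMod 2) {v | ∃ X : Finset (Fin n), X.card = k ∧ cliqueVec n X = v}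

/-- The edge-count parity map `e : F_2^{C(n,2)} → F_2`, `e(F) = |F| mod 2`. -/
def eMap (n : ℕ) : (PairIdx n → ZMod 2) →ₗ[ZMod 2] ZMod 2 :=
  ∑ p : PairIdx n, LinearMap.proj p

/-- The degree-parity map `∂ : F_2^{C(n,2)} → F_2^n`, `∂(F)_v = deg_F(v) mod 2`. -/
def dMap (n : ℕ) : (PairIdx n → ZMod 2) →ₗ[ZMod 2] (Fin n → ZMod 2) :=
  LinearMap.pi fun v =>
    ∑ p ∈ Finset.univ.filter (fun p : PairIdx n => p.1.1 = v ∨ p.1.2 = v),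
      LinearMap.proj p

/-- The indicator vector of the edge `{a, b}`. -/
def edgeVec (n : ℕ) (a b : Fin n) : PairIdx n → ZMod 2 :=
  fun p => if (p.1.1 = a ∧ p.1.2 = b) ∨ (p.1.1 = b ∧ p.1.2 = a) then 1 else 0

lemma edgeVec_comm {n : ℕ} (a b : Fin n) : edgeVec n a b = edgeVec n b a := by
  funext p
  simp only [edgeVec, or_comm]

lemma edgeVec_eq_single {n : ℕ} (p : PairIdx n) :
    edgeVec n p.1.1 p.1.2 = Pi.single p 1 := by
  funext q
  rw [Pi.single_apply, edgeVec]
  refine if_congr ⟨?_, fun h => h ▸ Or.inl ⟨rfl, rfl⟩⟩ rfl rfl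
  rintro (⟨h1, h2⟩ | ⟨h1, h2⟩)
  · exact Subtype.ext (Prod.ext h1 h2)
  · exact absurd p.2 (h1 ▸ h2 ▸ q.2.asymm)

/-- Edge vectors of distinct endpoints are standard basis vectors. -/
lemma exists_edgeVec_eq_single {n : ℕ} {a b : Fin n} (hab : a ≠ b) :
    ∃ p : PairIdx n, edgeVec n a b = Pi.single p 1 ∧
      ((p.1.1 = a ∧ p.1.2 = b) ∨ (p.1.1 = b ∧ p.1.2 = a)) := by
  rcases lt_or_gt_of_ne hab with h | h
  · exact ⟨⟨(a, b), h⟩, edgeVec_eq_single (⟨(a, b), h⟩ : PairIdx n), Or.inl ⟨rfl, rfl⟩⟩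
  · exact ⟨⟨(b, a), h⟩, (edgeVec_comm a b).trans (edgeVec_eq_single (⟨(b, a), h⟩ : PairIdx n)),
      Or.inr ⟨rfl, rfl⟩⟩

lemma eMap_single {n : ℕ} (p : PairIdx n) : eMap n (Pi.single p 1) = 1 := by
  simp [eMap, LinearMap.sum_apply]

lemma dMap_single {n : ℕ} (p : PairIdx n) (v : Fin n) :
    dMap n (Pi.single p 1) v = (if p.1.1 = v then 1 else 0) + (if p.1.2 = v then 1 else 0) := by
  have h : dMap n (Pi.single p 1) v = if p.1.1 = v ∨ p.1.2 = v then 1 else 0 := by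
    simp [dMap, LinearMap.sum_apply, Pi.single_apply, Finset.sum_ite_eq']
  rw [h]
  have hp : p.1.1 ≠ p.1.2 := ne_of_lt p.2
  by_cases h1 : p.1.1 = v <;> by_cases h2 : p.1.2 = v <;> simp [h1, h2]
  exact hp (h1.trans h2.symm)

lemma eMap_edgeVec {n : ℕ} {a b : Fin n} (hab : a ≠ b) : eMap n (edgeVec n a b) = 1 := by
  obtain ⟨p, hp, -⟩ := exists_edgeVec_eq_single hab
  rw [hp, eMap_single]

lemma dMap_edgeVec {n : ℕ} {a b : Fin n} (hab : a ≠ b) (v : Fin n) :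
    dMap n (edgeVec n a b) v = (if a = v then 1 else 0) + (if b = v then 1 else 0) := by
  obtain ⟨p, hp, ⟨h1, h2⟩ | ⟨h1, h2⟩⟩ := exists_edgeVec_eq_single hab
  · rw [hp, dMap_single, h1, h2]
  · rw [hp, dMap_single, h1, h2, add_comm]

lemma cliqueVec_empty (n : ℕ) : cliqueVec n ∅ = 0 := by
  funext p
  simp [cliqueVec]

lemma cliqueVec_insert {n : ℕ} {a : Fin n} {X : Finset (Fin n)} (ha : a ∉ X) :
    cliqueVec n (insert a X) = cliqueVec n X + ∑ b ∈ X, edgeVec n a b := by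
  funext p
  have hp : p.1.1 ≠ p.1.2 := ne_of_lt p.2
  simp only [cliqueVec, edgeVec, Pi.add_apply, Finset.sum_apply, Finset.mem_insert]
  generalize p.1.1 = c at hp ⊢
  generalize p.1.2 = d at hp ⊢
  by_cases hc : c = a
  · subst hc
    simp [ha, hp.symm, Finset.sum_ite_eq]
  · by_cases hd : d = a
    · subst hd
      simp [ha, hp, Finset.sum_ite_eq]
    · simp [hc, hd]

lemma eMap_cliqueVec {n : ℕ} (X : Finset (Fin n)) :
    eMap n (cliqueVec n X) = (X.card.choose 2 : ℕ) := by
  induction X using Finset.induction_on with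
  | empty => simp [cliqueVec_empty]
  | insert a X ha ih =>
    rw [cliqueVec_insert ha, map_add, ih, map_sum, Finset.card_insert_of_notMem ha,
      Finset.sum_congr rfl fun b hb => eMap_edgeVec (ne_of_mem_of_not_mem hb ha).symm,
      Nat.choose_succ_succ' X.card 1]
    simp [add_comm]

lemma dMap_cliqueVec {n : ℕ} (X : Finset (Fin n)) (v : Fin n) :
    dMap n (cliqueVec n X) v = if v ∈ X then (X.card : ZMod 2) + 1 else 0 := by
  induction X using Finset.induction_on with
  | empty => simp [cliqueVec_empty]
  | insert a X ha ih =>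
    rw [cliqueVec_insert ha, map_add, Pi.add_apply, ih, map_sum, Finset.sum_apply,
      Finset.card_insert_of_notMem ha,
      Finset.sum_congr rfl fun b hb => dMap_edgeVec (ne_of_mem_of_not_mem hb ha).symm v,
      Finset.sum_add_distrib, Finset.sum_ite_eq', Finset.sum_const]
    have h2 : (1 : ZMod 2) + 1 = 0 := by decide
    by_cases hv : v = a
    · subst hv
      simp [ha, add_assoc, h2]
    · simp [hv, Ne.symm hv]
      split_ifs <;> simp

/-- The value of a functional of the form `{a, b} ↦ u a + u b + t` on an edge set is determined
by its degree parities and its edge-count parity. -/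
lemma apply_eq_of_edgeVec {n : ℕ} (f : (PairIdx n → ZMod 2) →ₗ[ZMod 2] ZMod 2)
    (u : Fin n → ZMod 2) (t : ZMod 2)
    (h : ∀ a b, a ≠ b → f (edgeVec n a b) = u a + u b + t) (F : PairIdx n → ZMod 2) :
    f F = ∑ v, u v * dMap n F v + t * eMap n F := by
  let g : (PairIdx n → ZMod 2) →ₗ[ZMod 2] ZMod 2 :=
    ∑ v, u v • (LinearMap.proj v ∘ₗ dMap n) + t • eMap n
  have hg : ∀ F, g F = ∑ v, u v * dMap n F v + t * eMap n F := fun F => by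
    simp [g, LinearMap.sum_apply]
  rw [← hg]
  suffices f = g by rw [this]
  refine LinearMap.pi_ext' fun p => LinearMap.ext_ring ?_
  simp only [LinearMap.comp_apply, LinearMap.single_apply]
  rw [hg, ← edgeVec_eq_single, h _ _ (ne_of_lt p.2), eMap_edgeVec (ne_of_lt p.2)]
  simp [dMap_edgeVec (ne_of_lt p.2), mul_add, Finset.sum_add_distrib]

/-- A symmetric edge weighting in `F_2` that vanishes on all 4-cycles has the form
`u a + u b + t`. -/
lemma exists_potential {α : Type*} [DecidableEq α] (w : α → α → ZMod 2)
    (hw : ∀ a b, w a b = w b a)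
    (hcycle : ∀ a b c d, a ≠ b → a ≠ c → a ≠ d → b ≠ c → b ≠ d → c ≠ d →
      w a c + w a d + w b c + w b d = 0)
    {x y z : α} (hxy : x ≠ y) (hxz : x ≠ z) (hyz : y ≠ z) :
    ∃ (u : α → ZMod 2) (t : ZMod 2), ∀ a b, a ≠ b → w a b = u a + u b + t := by
  have h2 : ∀ s : ZMod 2, s + s = 0 := by decide
  have htri : ∀ a b c, x ≠ a → x ≠ b → x ≠ c → a ≠ b → a ≠ c →
      w x a + w x b + w a b = w x a + w x c + w a c := by
    intro a b c ha hb hc hab hac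
    by_cases hbc : b = c
    · rw [hbc]
    · have h := hcycle x a b c ha hb hc hab hac hbc
      have key : ∀ p q r s l : ZMod 2, p + q + r + s = 0 → l + p + r = l + q + s := by decide
      exact key _ _ _ _ _ h
  have hswap : ∀ a b, w x a + w x b + w a b = w x b + w x a + w b a := fun a b => by
    rw [hw a b, add_comm (w x a)]
  have hy : ∀ b, x ≠ b → y ≠ b → w x y + w x b + w y b = w x y + w x z + w y z :=
    fun b hb hyb => htri y b z hxy hb hxz hyb hyz
  have hconst : ∀ a b, x ≠ a → x ≠ b → a ≠ b →
      w x a + w x b + w a b = w x y + w x z + w y z := by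
    intro a b ha hb hab
    by_cases hay : a = y
    · subst hay
      exact hy b hb hab
    · rw [htri a b y ha hb hxy hab hay, hswap]
      exact hy a ha (Ne.symm hay)
  refine ⟨fun a => if a = x then w x y + w x z + w y z else w x a,
    w x y + w x z + w y z, fun a b hab => ?_⟩
  have key : ∀ p q r t : ZMod 2, p + q + r = t → r = p + q + t := by decide
  have key1 : ∀ r t : ZMod 2, r = t + r + t := by decide
  have key2 : ∀ r t : ZMod 2, r = r + t + t := by decide
  by_cases ha : a = x
  · subst ha
    simp only [if_true, if_neg hab.symm]
    exact key1 _ _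
  · by_cases hb : b = x
    · subst hb
      simp only [if_true, if_neg hab]
      rw [hw a b]
      exact key2 _ _
    · simp only [if_neg ha, if_neg hb]
      exact key _ _ _ _ (hconst a b (Ne.symm ha) (Ne.symm hb) hab)

lemma cliqueVec_insert_insert {n : ℕ} {a b : Fin n} {S : Finset (Fin n)} (ha : a ∉ S)
    (hb : b ∉ S) (hab : a ≠ b) :
    cliqueVec n (insert a (insert b S)) = cliqueVec n S + ∑ s ∈ S, edgeVec n b s +
      (edgeVec n a b + ∑ s ∈ S, edgeVec n a s) := by
  rw [cliqueVec_insert (by simp [ha, hab]), cliqueVec_insert hb, Finset.sum_insert hb]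

/-- A functional vanishing on all `k`-cliques vanishes on all 4-cycles. -/
lemma cycle_eq_zero_of_cliqueVec {n k : ℕ} (hk : 2 ≤ k) (hkn : k + 2 ≤ n)
    (f : (PairIdx n → ZMod 2) →ₗ[ZMod 2] ZMod 2)
    (hf : ∀ X : Finset (Fin n), X.card = k → f (cliqueVec n X) = 0)
    (a b c d : Fin n) (hab : a ≠ b) (hac : a ≠ c) (had : a ≠ d) (hbc : b ≠ c) (hbd : b ≠ d)
    (hcd : c ≠ d) :
    f (edgeVec n a c) + f (edgeVec n a d) + f (edgeVec n b c) + f (edgeVec n b d) = 0 := by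
  have hcard : ({a, b, c, d} : Finset (Fin n)).card = 4 := by
    simp [*]
  have hcompl : k - 2 ≤ (({a, b, c, d} : Finset (Fin n))ᶜ).card := by
    rw [Finset.card_compl, hcard, Fintype.card_fin]
    omega
  obtain ⟨S, hS, hScard⟩ := Finset.exists_subset_card_eq hcompl
  have hnot : ∀ e ∈ ({a, b, c, d} : Finset (Fin n)), e ∉ S := fun e he heS =>
    Finset.mem_compl.1 (hS heS) he
  have ha := hnot a (by simp)
  have hb := hnot b (by simp)
  have hc := hnot c (by simp)
  have hd := hnot d (by simp)
  have hpair : ∀ e g, e ∉ S → g ∉ S → e ≠ g → f (cliqueVec n S + ∑ s ∈ S, edgeVec n g s +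
      (edgeVec n e g + ∑ s ∈ S, edgeVec n e s)) = 0 := by
    intro e g he hg heg
    rw [← cliqueVec_insert_insert he hg heg]
    refine hf _ ?_
    rw [Finset.card_insert_of_notMem (by simp [he, heg]), Finset.card_insert_of_notMem hg, hScard]
    omega
  have h1 := hpair a c ha hc hac
  have h2 := hpair a d ha hd had
  have h3 := hpair b c hb hc hbc
  have h4 := hpair b d hb hd hbd
  simp only [map_add] at h1 h2 h3 h4
  have hchar : (2 : ZMod 2) = 0 := by decide
  linear_combination h1 + h2 + h3 + h4 - (2 * f (cliqueVec n S) + f (∑ s ∈ S, edgeVec n a s) +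
    f (∑ s ∈ S, edgeVec n b s) + f (∑ s ∈ S, edgeVec n c s) + f (∑ s ∈ S, edgeVec n d s)) * hchar

lemma natCast_choose_two_of_mod_four {k : ℕ} (h : k % 4 = 3) : (k.choose 2 : ZMod 2) = 1 := by
  obtain ⟨m, rfl⟩ : ∃ m, k = 4 * m + 3 := ⟨k / 4, by omega⟩
  have hc : (4 * m + 3).choose 2 = 2 * (4 * m * m + 5 * m + 1) + 1 := by
    rw [Nat.choose_two_right, Nat.add_sub_assoc (by norm_num)]
    refine Nat.div_eq_of_eq_mul_left (by norm_num) ?_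
    norm_num
    ring
  rw [hc, Nat.cast_add, Nat.cast_mul]
  have hchar : ((2 : ℕ) : ZMod 2) = 0 := by decide
  rw [hchar]
  simp

/-- For `n ≥ 4`, `2 ≤ k ≤ n - 2` and `k ≡ 3 (mod 4)`, the span `H_k` of the `k`-clique
vectors equals `ker(∂)`, the subspace of edge-sets in which every vertex has even
degree. -/
theorem Hk_eq_ker_deg (n k : ℕ) (hn : 4 ≤ n) (hk2 : 2 ≤ k) (hkn : k ≤ n - 2)
    (hmod : k % 4 = 3) : Hk n k = LinearMap.ker (dMap n) := by
  have hdeg : ∀ X : Finset (Fin n), X.card = k → dMap n (cliqueVec n X) = 0 := by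
    intro X hX
    funext v
    have hodd : (k : ZMod 2) + 1 = 0 := by
      rw [← Nat.cast_succ, ZMod.natCast_eq_zero_iff]
      omega
    rw [dMap_cliqueVec, hX, hodd, ite_self, Pi.zero_apply]
  apply le_antisymm
  · refine Submodule.span_le.2 ?_
    rintro _ ⟨X, hX, rfl⟩
    exact hdeg X hX
  · intro F hF
    by_contra hFH
    obtain ⟨f, hfF, hfH⟩ := Submodule.exists_le_ker_of_notMem hFH
    have hf : ∀ X : Finset (Fin n), X.card = k → f (cliqueVec n X) = 0 := fun X hX =>
      hfH (Submodule.subset_span ⟨X, hX, rfl⟩)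
    obtain ⟨u, t, hut⟩ := exists_potential (fun a b => f (edgeVec n a b))
      (fun a b => by rw [edgeVec_comm])
      (cycle_eq_zero_of_cliqueVec hk2 (by omega) f hf)
      (x := (⟨0, by omega⟩ : Fin n)) (y := ⟨1, by omega⟩) (z := ⟨2, by omega⟩)
      (by simp) (by simp) (by simp)
    have happ := apply_eq_of_edgeVec f u t hut
    obtain ⟨X, -, hX⟩ := Finset.exists_subset_card_eq
      (s := (Finset.univ : Finset (Fin n))) (n := k) (by rw [Finset.card_fin]; omega)
    have ht : t = 0 := by
      have h := happ (cliqueVec n X)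
      rw [hf X hX, hdeg X hX, eMap_cliqueVec, hX, natCast_choose_two_of_mod_four hmod] at h
      simpa using h.symm
    refine hfF ?_
    rw [happ F, LinearMap.mem_ker.1 hF, ht]
    simp
end
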